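/- Let k be a field, R = k[[x,y]]/(x^2 y), and for an integer n ≥ 1 define the R-modules M_n^+ = coker of the R-linear map R^{⊕2} → R^{⊕2} given by the matrix [[x, y^n],[0, -x]] and M_n^- = coker of the R-linear map R^{⊕2} → R^{⊕2} given by the matrix [[xy, y^{n+1}],[0, -xy]] (entries are residue classes in R). Then M_n^+ ⇒_deg M_{n+2}^+ and M_n^- ⇒_deg M_{n+2}^-. -/

import Mathlib

open Polynomial TensorProduct

noncomputable section

/-- The prime ideal `(t)` of the polynomial ring `k[t]`. -/
def tIdeal (k : Type) [Field k] : Ideal (Polynomial k) := Ideal.span {Polynomial.X}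

instance tIdeal_isPrime (k : Type) [Field k] : (tIdeal k).IsPrime := by
  have h : tIdeal k = RingHom.ker (Polynomial.evalRingHom (0 : k)) := by
    rw [Polynomial.ker_evalRingHom]
    simp [tIdeal]
  rw [h]
  exact RingHom.ker_isPrime _

/-- `V = k[t]_{(t)}`, the localization of the polynomial ring `k[t]` at the prime ideal `(t)`. -/
def DegV (k : Type) [Field k] : Type := Localization.AtPrime (tIdeal k)

instance (k : Type) [Field k] : CommRing (DegV k) :=
  inferInstanceAs (CommRing (Localization.AtPrime (tIdeal k)))

instance (k : Type) [Field k] : Algebra (Polynomial k) (DegV k) :=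
  inferInstanceAs (Algebra (Polynomial k) (Localization.AtPrime (tIdeal k)))

instance (k : Type) [Field k] : Algebra k (DegV k) :=
  inferInstanceAs (Algebra k (Localization.AtPrime (tIdeal k)))

instance (k : Type) [Field k] : IsScalarTower k (Polynomial k) (DegV k) :=
  inferInstanceAs (IsScalarTower k (Polynomial k) (Localization.AtPrime (tIdeal k)))

/-- The element `t` of `V = k[t]_{(t)}`. -/
def degT (k : Type) [Field k] : DegV k := algebraMap (Polynomial k) (DegV k) Polynomial.X

/-- `K = V[t⁻¹]`, which is the fraction field `k(t)` of `V = k[t]_{(t)}`. -/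
def DegK (k : Type) [Field k] : Type := Localization (Submonoid.powers (degT k))

instance (k : Type) [Field k] : CommRing (DegK k) :=
  inferInstanceAs (CommRing (Localization (Submonoid.powers (degT k))))

instance (k : Type) [Field k] : Algebra (DegV k) (DegK k) :=
  inferInstanceAs (Algebra (DegV k) (Localization (Submonoid.powers (degT k))))

instance (k : Type) [Field k] : Algebra k (DegK k) :=
  inferInstanceAs (Algebra k (Localization (Submonoid.powers (degT k))))

/-- The localized module `Q[t⁻¹]` is a module over `K = V[t⁻¹]`. -/
instance (k : Type) [Field k] (Q : Type) [AddCommGroup Q] [Module (DegV k) Q] :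
    Module (DegK k) (LocalizedModule (Submonoid.powers (degT k)) Q) :=
  inferInstanceAs (Module (Localization (Submonoid.powers (degT k)))
    (LocalizedModule (Submonoid.powers (degT k)) Q))

section

variable (k : Type) [Field k] (R : Type) [Ring R] [Algebra k R]

/-- `1 ⊗ t` is central in `R ⊗[k] V`. -/
theorem degT_central (x : R ⊗[k] DegV k) :
    x * ((1 : R) ⊗ₜ[k] degT k) = ((1 : R) ⊗ₜ[k] degT k) * x := by
  induction x with
  | zero => simp
  | tmul a v => simp [Algebra.TensorProduct.tmul_mul_tmul, mul_comm]
  | add x y hx hy => simp [add_mul, mul_add, hx, hy]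

/-- Multiplication by `1 ⊗ t` on an `R ⊗[k] V`-module, as an `R ⊗[k] V`-linear map. -/
def tSmul (Q : Type) [AddCommGroup Q] [Module (R ⊗[k] DegV k) Q] :
    Q →ₗ[R ⊗[k] DegV k] Q where
  toFun q := ((1 : R) ⊗ₜ[k] degT k) • q
  map_add' := smul_add _
  map_smul' x q := by
    simp only [RingHom.id_apply, ← mul_smul, degT_central]

/-- The `R`-module structure on an `R ⊗[k] V`-module obtained by restriction of scalars
along `R → R ⊗[k] V`. -/
def rRestrict (Q : Type) [AddCommGroup Q] [Module (R ⊗[k] DegV k) Q] : Module R Q :=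
  Module.compHom Q (Algebra.TensorProduct.includeLeftRingHom : R →+* R ⊗[k] DegV k)

/-- The `V`-module structure on an `R ⊗[k] V`-module obtained by restriction of scalars
along `V → R ⊗[k] V`. -/
def vRestrict (Q : Type) [AddCommGroup Q] [Module (R ⊗[k] DegV k) Q] : Module (DegV k) Q :=
  Module.compHom Q
    ((Algebra.TensorProduct.includeRight : DegV k →ₐ[k] R ⊗[k] DegV k) : DegV k →+* R ⊗[k] DegV k)

/-- The action of `r : R` on an `R ⊗[k] V`-module `Q`, as a `V`-linear endomorphism of `Q`. -/
def rAct (Q : Type) [AddCommGroup Q] [Module (R ⊗[k] DegV k) Q] (r : R) :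
    letI := vRestrict k R Q
    Q →ₗ[DegV k] Q :=
  letI := vRestrict k R Q
  { toFun := fun q => (r ⊗ₜ[k] (1 : DegV k)) • q
    map_add' := smul_add _
    map_smul' := fun v q => by
      show (r ⊗ₜ[k] (1 : DegV k)) • (((1 : R) ⊗ₜ[k] v) • q)
        = ((1 : R) ⊗ₜ[k] v) • ((r ⊗ₜ[k] (1 : DegV k)) • q)
      rw [← mul_smul, ← mul_smul, Algebra.TensorProduct.tmul_mul_tmul,
        Algebra.TensorProduct.tmul_mul_tmul, one_mul, mul_one, one_mul, mul_one] }

/-- The action of `r : R` on a module `M`, as a `k`-linear endomorphism of `M`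
(where `M` is viewed as a `k`-module by restriction of scalars along `k → R`). -/
def rActK (M : Type) [AddCommGroup M] [Module R M] (r : R) :
    letI := Module.compHom M (algebraMap k R)
    M →ₗ[k] M :=
  letI := Module.compHom M (algebraMap k R)
  { toFun := fun m => r • m
    map_add' := smul_add r
    map_smul' := fun c m => by
      show r • ((algebraMap k R c) • m) = (algebraMap k R c) • (r • m)
      rw [← mul_smul, ← mul_smul, Algebra.commutes] }

/-- Degeneration of modules (Yoshino): `M ⇒_deg N` iff there is a finitely generated
`R ⊗[k] V`-module `Q`, flat over `V`, with `Q/tQ ≅ N` as `R`-modules and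
`Q_t = Q[t⁻¹] ≅ M ⊗[k] K` compatibly with the `R`- and `K`-actions
(i.e. as `R ⊗[k] K`-modules). -/
def Degenerates (M N : Type) [AddCommGroup M] [Module R M] [AddCommGroup N] [Module R N] :
    Prop :=
  ∃ (Q : Type) (_ : AddCommGroup Q) (_ : Module (R ⊗[k] DegV k) Q),
    Module.Finite (R ⊗[k] DegV k) Q ∧
    (letI := vRestrict k R Q; Module.Flat (DegV k) Q) ∧
    -- `Q/tQ ≅ N` as `R`-modules
    (letI := rRestrict k R (Q ⧸ LinearMap.range (tSmul k R Q))
     Nonempty ((Q ⧸ LinearMap.range (tSmul k R Q)) ≃ₗ[R] N)) ∧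
    -- `Q_t ≅ M ⊗_k K` as `R ⊗_k K`-modules, i.e. compatibly with both actions
    (letI := vRestrict k R Q
     letI : Module k M := Module.compHom M (algebraMap k R)
     ∃ f : LocalizedModule (Submonoid.powers (degT k)) Q ≃+ (M ⊗[k] DegK k),
       (∀ (c : DegK k) (x : LocalizedModule (Submonoid.powers (degT k)) Q),
          f (c • x) = LinearMap.lTensor M (LinearMap.mulLeft k c) (f x)) ∧
       (∀ (r : R) (x : LocalizedModule (Submonoid.powers (degT k)) Q),
          f (LocalizedModule.map (Submonoid.powers (degT k)) (rAct k R Q r) x)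
            = LinearMap.rTensor (DegK k) (rActK k R M r) (f x)))

end

/-- The ring `R = k[[x,y]]/(x²y)`. -/
abbrev DinfRing (k : Type) [Field k] : Type :=
  MvPowerSeries (Fin 2) k ⧸ Ideal.span {(MvPowerSeries.X (0 : Fin 2) : MvPowerSeries (Fin 2) k) ^ 2 * (MvPowerSeries.X (1 : Fin 2) : MvPowerSeries (Fin 2) k)}

/-- The residue class of `x` in `R = k[[x,y]]/(x²y)`. -/
def dx (k : Type) [Field k] : DinfRing k := Ideal.Quotient.mk _ ((MvPowerSeries.X (0 : Fin 2) : MvPowerSeries (Fin 2) k))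

/-- The residue class of `y` in `R = k[[x,y]]/(x²y)`. -/
def dy (k : Type) [Field k] : DinfRing k := Ideal.Quotient.mk _ ((MvPowerSeries.X (1 : Fin 2) : MvPowerSeries (Fin 2) k))

/-- `Mₙ⁺ = coker [[x, yⁿ],[0, -x]]` over `R = k[[x,y]]/(x²y)`. -/
abbrev Mplus (k : Type) [Field k] (n : ℕ) : Type :=
  (Fin 2 → DinfRing k) ⧸
    LinearMap.range (Matrix.toLin' !![dx k, dy k ^ n; 0, -dx k])

/-- `Mₙ⁻ = coker [[xy, yⁿ⁺¹],[0, -xy]]` over `R = k[[x,y]]/(x²y)`. -/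
abbrev Mminus (k : Type) [Field k] (n : ℕ) : Type :=
  (Fin 2 → DinfRing k) ⧸
    LinearMap.range (Matrix.toLin' !![dx k * dy k, dy k ^ (n + 1); 0, -(dx k * dy k)])

/-! ### The valuation ring `V` -/

instance degV_isLoc (k : Type) [Field k] :
    IsLocalization.AtPrime (DegV k) (tIdeal k) :=
  inferInstanceAs (IsLocalization.AtPrime (Localization.AtPrime (tIdeal k)) (tIdeal k))

instance degK_isLoc (k : Type) [Field k] :
    IsLocalization (Submonoid.powers (degT k)) (DegK k) :=
  inferInstanceAs (IsLocalization _ (Localization (Submonoid.powers (degT k))))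

instance degK_tower (k : Type) [Field k] : IsScalarTower k (DegV k) (DegK k) :=
  inferInstanceAs (IsScalarTower k (DegV k)
    (Localization (Submonoid.powers (degT k))))

instance degV_isDomain (k : Type) [Field k] : IsDomain (DegV k) :=
  IsLocalization.isDomain_localization (tIdeal k).primeCompl_le_nonZeroDivisors

instance degV_isDedekind (k : Type) [Field k] : IsDedekindDomain (DegV k) :=
  IsLocalization.isDedekindDomain k[X] (tIdeal k).primeCompl_le_nonZeroDivisors (DegV k)

theorem mem_tIdeal_iff (k : Type) [Field k] (p : k[X]) : p ∈ tIdeal k ↔ p.eval 0 = 0 := by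
  rw [tIdeal, Ideal.mem_span_singleton, Polynomial.X_dvd_iff, Polynomial.coeff_zero_eq_eval_zero]

/-- Evaluation at `t = 0`. -/
def evV (k : Type) [Field k] : DegV k →ₐ[k] k :=
  IsLocalization.liftAlgHom (M := (tIdeal k).primeCompl) (f := Polynomial.aeval (0 : k)) (by
    intro y
    have h : y.1 ∉ tIdeal k := y.2
    rw [mem_tIdeal_iff] at h
    simpa [Polynomial.aeval_def, Polynomial.eval₂_eq_eval_map] using h)

theorem evV_algebraMap (k : Type) [Field k] (p : k[X]) :
    evV k (algebraMap _ _ p) = p.eval 0 := by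
  simp [evV]

theorem evV_t (k : Type) [Field k] : evV k (degT k) = 0 := by
  rw [degT, evV_algebraMap]; simp

theorem degV_ker (k : Type) [Field k] (v : DegV k) (h : evV k v = 0) : ∃ w, v = degT k * w := by
  obtain ⟨p, s, rfl⟩ := IsLocalization.exists_mk'_eq (tIdeal k).primeCompl v
  have h2 := IsLocalization.mk'_spec (DegV k) p s
  have h3 : p.eval 0 = 0 := by
    rw [← evV_algebraMap, ← h2, map_mul, h, zero_mul]
  rw [← Polynomial.coeff_zero_eq_eval_zero, ← Polynomial.X_dvd_iff] at h3
  obtain ⟨q, rfl⟩ := h3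
  refine ⟨IsLocalization.mk' _ q s, ?_⟩
  rw [degT, IsLocalization.mul_mk'_eq_mk'_of_mul]

theorem degV_unit (k : Type) [Field k] (v : DegV k) (h : evV k v ≠ 0) : IsUnit v := by
  obtain ⟨p, s, rfl⟩ := IsLocalization.exists_mk'_eq (tIdeal k).primeCompl v
  have h2 := IsLocalization.mk'_spec (DegV k) p s
  have h3 : p ∉ tIdeal k := by
    rw [mem_tIdeal_iff, ← evV_algebraMap, ← h2, map_mul]
    refine mul_ne_zero h ?_
    rw [evV_algebraMap]
    have := s.2
    rwa [Ideal.mem_primeCompl_iff, mem_tIdeal_iff] at this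
  have h4 := IsLocalization.map_units (DegV k) (⟨p, h3⟩ : (tIdeal k).primeCompl)
  simp only at h4
  rw [← h2] at h4
  exact isUnit_of_mul_isUnit_left h4

theorem degV_split (k : Type) [Field k] (v : DegV k) :
    ∃ w, v = algebraMap k _ (evV k v) + degT k * w := by
  obtain ⟨w, hw⟩ := degV_ker k (v - algebraMap k _ (evV k v)) (by simp)
  exact ⟨w, by rw [← hw]; ring⟩

theorem degT_ne (k : Type) [Field k] : degT k ≠ 0 := by
  rw [degT, Ne, IsLocalization.to_map_eq_zero_iff (M := (tIdeal k).primeCompl) _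
    (tIdeal k).primeCompl_le_nonZeroDivisors]
  exact Polynomial.X_ne_zero

theorem degT_irr (k : Type) [Field k] : Irreducible (degT k) := by
  refine Prime.irreducible ⟨degT_ne k, ?_, ?_⟩
  · intro h
    have := h.map (evV k)
    rw [evV_t] at this
    exact not_isUnit_zero this
  · intro a b ⟨c, hc⟩
    have : evV k a * evV k b = 0 := by rw [← map_mul, hc, map_mul, evV_t, zero_mul]
    rcases mul_eq_zero.1 this with h | h
    · obtain ⟨w, hw⟩ := degV_ker k a h
      exact Or.inl ⟨w, hw⟩
    · obtain ⟨w, hw⟩ := degV_ker k b h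
      exact Or.inr ⟨w, hw⟩

/-- Flatness over `V` is `t`-torsion-freeness. -/
theorem flat_of_t (k : Type) [Field k] (Q : Type) [AddCommGroup Q] [Module (DegV k) Q]
    (h : ∀ q : Q, degT k • q = 0 → q = 0) : Module.Flat (DegV k) Q := by
  have key : ∀ n : ℕ, ∀ q : Q, degT k ^ n • q = 0 → q = 0 := by
    intro n
    induction n with
    | zero => intro q hq; simpa using hq
    | succ n ih =>
      intro q hq
      rw [pow_succ, mul_smul] at hq
      exact h _ (ih _ hq)
  rw [IsDedekindDomain.flat_iff_torsion_eq_bot, eq_bot_iff]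
  intro q hq
  obtain ⟨⟨a, ha⟩, haq⟩ := (Submodule.mem_torsion_iff q).1 hq
  have ha0 : a ≠ 0 := nonZeroDivisors.ne_zero ha
  obtain ⟨n, b, hb, rfl⟩ := WfDvdMonoid.max_power_factor ha0 (degT_irr k)
  have hu : IsUnit b := degV_unit k b (fun h0 => hb (by
    obtain ⟨w, hw⟩ := degV_ker k b h0
    exact ⟨w, hw⟩))
  have h1 : (degT k ^ n * b) • q = 0 := haq
  rw [mul_smul] at h1
  have := key _ _ h1
  simpa [hu.smul_eq_zero] using this

/-! ### The generic fibre -/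

section loc

variable (k : Type) [Field k] (M : Type) [AddCommGroup M] [Module k M]

/-- The map `M ⊗ V → K ⊗ M`. -/
def jMap : M ⊗[k] DegV k →ₗ[k] DegK k ⊗[k] M :=
  (TensorProduct.comm k M (DegK k)).toLinearMap ∘ₗ
    LinearMap.lTensor M (IsScalarTower.toAlgHom k (DegV k) (DegK k)).toLinearMap

theorem jMap_tmul (m : M) (v : DegV k) :
    jMap k M (m ⊗ₜ v) = algebraMap (DegV k) (DegK k) v ⊗ₜ m := by
  simp [jMap]

theorem algMapVK_inj : Function.Injective (algebraMap (DegV k) (DegK k)) :=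
  IsLocalization.injective (M := Submonoid.powers (degT k)) _
    (powers_le_nonZeroDivisors_of_noZeroDivisors (degT_ne k))

theorem jMap_inj : Function.Injective (jMap k M) := by
  refine (TensorProduct.comm k M (DegK k)).injective.comp ?_
  exact Module.Flat.lTensor_preserves_injective_linearMap (M := M)
    (IsScalarTower.toAlgHom k (DegV k) (DegK k)).toLinearMap (algMapVK_inj k)

theorem jMap_smul (v : DegV k) (z : M ⊗[k] DegV k) :
    jMap k M (LinearMap.lTensor M (LinearMap.mulLeft k v) z) = v • jMap k M z := by
  induction z with
  | zero => simp
  | add x y hx hy => simp only [map_add, hx, hy, smul_add]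
  | tmul m w =>
    rw [LinearMap.lTensor_tmul, jMap_tmul, jMap_tmul, LinearMap.mulLeft_apply, map_mul,
      TensorProduct.smul_tmul', Algebra.smul_def]

theorem degK_frac (c : DegK k) : ∃ (n : ℕ) (v : DegV k),
    algebraMap (DegV k) (DegK k) (degT k ^ n) * c = algebraMap (DegV k) (DegK k) v := by
  obtain ⟨v, s, rfl⟩ := IsLocalization.exists_mk'_eq (Submonoid.powers (degT k)) c
  obtain ⟨n, hn⟩ := (Submonoid.mem_powers_iff _ _).1 s.2
  exact ⟨n, v, by rw [hn, IsLocalization.mk'_spec']⟩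

theorem jMap_surj (w : DegK k ⊗[k] M) : ∃ (n : ℕ) (z : M ⊗[k] DegV k),
    degT k ^ n • w = jMap k M z := by
  induction w with
  | zero => exact ⟨0, 0, by simp⟩
  | tmul c m =>
    obtain ⟨n, v, hc⟩ := degK_frac k c
    refine ⟨n, m ⊗ₜ v, ?_⟩
    rw [jMap_tmul, TensorProduct.smul_tmul', Algebra.smul_def, hc]
  | add x y hx hy =>
    obtain ⟨a, z, hz⟩ := hx
    obtain ⟨b, z', hz'⟩ := hy
    refine ⟨a + b, LinearMap.lTensor M (LinearMap.mulLeft k (degT k ^ b)) z +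
      LinearMap.lTensor M (LinearMap.mulLeft k (degT k ^ a)) z', ?_⟩
    rw [map_add, jMap_smul, jMap_smul, ← hz, ← hz', smul_smul, smul_smul, ← pow_add, ← pow_add,
      smul_add, add_comm b a]

theorem t_bij (n : ℕ) : Function.Bijective (fun w : DegK k ⊗[k] M => degT k ^ n • w) := by
  have hu : IsUnit (algebraMap (DegV k) (DegK k) (degT k ^ n)) :=
    IsLocalization.map_units (DegK k) (⟨degT k ^ n, n, rfl⟩ : Submonoid.powers (degT k))
  have := MulAction.bijective (β := DegK k ⊗[k] M) hu.unit
  convert this using 2 with w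
  rw [Units.smul_def, IsUnit.unit_spec, algebraMap_smul]

theorem comm_lT (c : DegK k) (w : DegK k ⊗[k] M) :
    TensorProduct.comm k (DegK k) M (c • w) =
      LinearMap.lTensor M (LinearMap.mulLeft k c) (TensorProduct.comm k (DegK k) M w) := by
  induction w with
  | zero => simp
  | add x y hx hy => simp only [map_add, hx, hy, smul_add]
  | tmul a m => simp [TensorProduct.smul_tmul']

theorem loc_clause (R : Type) [CommRing R] [Algebra k R] [Module R M] [IsScalarTower k R M]
    (Q : Type) [AddCommGroup Q] [Module (DegV k) Q] (rho : R → Q →ₗ[DegV k] Q)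
    (h : Q →+ M ⊗[k] DegV k)
    (hv : ∀ v q, h (v • q) = LinearMap.lTensor M (LinearMap.mulLeft k v) (h q))
    (hr : ∀ r q, h (rho r q) = LinearMap.rTensor (DegV k) (Algebra.lsmul k k M r) (h q))
    (hk : ∀ q, h q = 0 → ∃ c : ℕ, degT k ^ c • q = 0)
    (hs : ∀ z, ∃ (c : ℕ) (q : Q), h q = LinearMap.lTensor M (LinearMap.mulLeft k (degT k ^ c)) z) :
    ∃ f : LocalizedModule (Submonoid.powers (degT k)) Q ≃+ (M ⊗[k] DegK k),
       (∀ (c : DegK k) (x : LocalizedModule (Submonoid.powers (degT k)) Q),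
          f (c • x) = LinearMap.lTensor M (LinearMap.mulLeft k c) (f x)) ∧
       (∀ (r : R) (x : LocalizedModule (Submonoid.powers (degT k)) Q),
          f (LocalizedModule.map (Submonoid.powers (degT k)) (rho r) x)
            = LinearMap.rTensor (DegK k) (Algebra.lsmul k k M r) (f x)) := by
  let g : Q →ₗ[DegV k] DegK k ⊗[k] M :=
    { toFun := fun q => jMap k M (h q)
      map_add' := fun a b => by simp
      map_smul' := fun v q => by rw [hv, jMap_smul]; rfl }
  have hg : ∀ q, g q = jMap k M (h q) := fun _ => rfl
  have : IsLocalizedModule (Submonoid.powers (degT k)) g := by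
    refine ⟨?_, ?_, ?_⟩
    · rintro ⟨_, n, rfl⟩
      rw [Module.End.isUnit_iff]
      exact t_bij k M n
    · intro w
      obtain ⟨n, z, hz⟩ := jMap_surj k M w
      obtain ⟨c, q, hq⟩ := hs z
      refine ⟨⟨q, ⟨degT k ^ (c + n), c + n, rfl⟩⟩, ?_⟩
      show degT k ^ (c + n) • w = g q
      rw [hg, hq, jMap_smul, ← hz, smul_smul, pow_add]
    · intro a b hab
      rw [hg, hg] at hab
      have h1 := jMap_inj k M hab
      obtain ⟨c, hc⟩ := hk (a - b) (by rw [map_sub, h1, sub_self])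
      refine ⟨⟨degT k ^ c, c, rfl⟩, ?_⟩
      show degT k ^ c • a = degT k ^ c • b
      rwa [smul_sub, sub_eq_zero] at hc
  let e := IsLocalizedModule.iso (Submonoid.powers (degT k)) g
  have he : ∀ (q : Q) (s : Submonoid.powers (degT k)),
      (s : DegV k) • e (LocalizedModule.mk q s) = g q := by
    intro q s
    rw [← map_smul, LocalizedModule.smul'_mk]
    have := LocalizedModule.mk_cancel (S := Submonoid.powers (degT k)) s q
    erw [this]
    exact IsLocalizedModule.iso_mk_one _ _ _
  refine ⟨e.toAddEquiv.trans (TensorProduct.comm k (DegK k) M).toAddEquiv, ?_, ?_⟩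
  · intro c x
    show TensorProduct.comm k (DegK k) M (e (c • x)) = _
    have h1 : e (c • x) = c • e x := by
      obtain ⟨n, v, hc⟩ := degK_frac k c
      apply (t_bij k M n).1
      show degT k ^ n • _ = degT k ^ n • _
      rw [← map_smul]
      have h2 : degT k ^ n • c • x = v • x := by
        have h3 : ∀ (a : DegV k) (y : LocalizedModule (Submonoid.powers (degT k)) Q),
            a • y = (algebraMap (DegV k) (DegK k) a) • y := fun a y =>
          (algebraMap_smul (Localization (Submonoid.powers (degT k))) a y).symm
        rw [h3, h3, smul_smul, hc]
      rw [h2, map_smul, ← smul_assoc, Algebra.smul_def, hc, algebraMap_smul]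
    rw [h1, comm_lT]
    rfl
  · intro r x
    induction x using LocalizedModule.induction_on with
    | h q s =>
      obtain ⟨n, hn⟩ := (Submonoid.mem_powers_iff _ _).1 s.2
      rw [LocalizedModule.map_mk]
      show TensorProduct.comm k (DegK k) M (e (LocalizedModule.mk (rho r q) s)) =
        LinearMap.rTensor (DegK k) (Algebra.lsmul k k M r) (TensorProduct.comm k (DegK k) M
          (e (LocalizedModule.mk q s)))
      have h1 : ∀ w : DegK k ⊗[k] M, LinearMap.rTensor (DegK k) (Algebra.lsmul k k M r)
          (TensorProduct.comm k (DegK k) M w) = TensorProduct.comm k (DegK k) M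
            (LinearMap.lTensor (DegK k) (Algebra.lsmul k k M r) w) := by
        intro w
        induction w with
        | zero => simp
        | add x y hx hy => simp only [map_add, hx, hy]
        | tmul a m => simp
      have h2 : ∀ (v : DegV k) (w : DegK k ⊗[k] M),
          LinearMap.lTensor (DegK k) (Algebra.lsmul k k M r) (v • w) =
          v • LinearMap.lTensor (DegK k) (Algebra.lsmul k k M r) w := by
        intro v w
        induction w with
        | zero => simp
        | add x y hx hy => simp only [map_add, hx, hy, smul_add]
        | tmul a m => simp [TensorProduct.smul_tmul']
      have h3 : ∀ z : M ⊗[k] DegV k, jMap k M (LinearMap.rTensor (DegV k) (Algebra.lsmul k k M r) z)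
          = LinearMap.lTensor (DegK k) (Algebra.lsmul k k M r) (jMap k M z) := by
        intro w
        induction w with
        | zero => simp
        | add x y hx hy => simp only [map_add, hx, hy]
        | tmul a m => simp [jMap_tmul]
      rw [h1]
      congr 1
      apply (t_bij k M n).1
      show degT k ^ n • _ = degT k ^ n • _
      rw [← h2, hn, he, he, hg, hg, hr, h3]

end loc

/-! ### Families of cokernels of `2 × 2` matrices over `R ⊗ V` -/

section core

variable (k : Type) [Field k] (R : Type) [CommRing R] [Algebra k R]

/-- Evaluation at `t = 0` on `R ⊗ V`. -/
def evS : R ⊗[k] DegV k →ₐ[k] R :=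
  Algebra.TensorProduct.lift (AlgHom.id k R) ((Algebra.ofId k R).comp (evV k))
    (fun _ _ => Commute.all _ _)

theorem evS_tmul (r : R) (v : DegV k) : evS k R (r ⊗ₜ v) = r * algebraMap k R (evV k v) := by
  simp [evS, Algebra.ofId_apply]

/-- The constant extension `R → R ⊗ V`. -/
def iS : R →ₐ[k] R ⊗[k] DegV k := Algebra.TensorProduct.includeLeft

theorem iS_apply (r : R) : iS k R r = r ⊗ₜ 1 := rfl

theorem evS_iS (r : R) : evS k R (iS k R r) = r := by
  simp [iS_apply, evS_tmul]

/-- The parameter `t` in `R ⊗ V`. -/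
def tS : R ⊗[k] DegV k := 1 ⊗ₜ degT k

theorem evS_tS : evS k R (tS k R) = 0 := by
  simp [tS, evS_tmul, evV_t]

theorem evS_split (s : R ⊗[k] DegV k) : ∃ s', s = iS k R (evS k R s) + tS k R * s' := by
  induction s with
  | zero => exact ⟨0, by simp⟩
  | add x y hx hy =>
    obtain ⟨a, ha⟩ := hx
    obtain ⟨b, hb⟩ := hy
    refine ⟨a + b, ?_⟩
    rw [map_add, map_add, mul_add]
    linear_combination ha + hb
  | tmul r v =>
    obtain ⟨w, hw⟩ := degV_split k v
    refine ⟨r ⊗ₜ w, ?_⟩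
    rw [evS_tmul, iS_apply, tS, Algebra.TensorProduct.tmul_mul_tmul, one_mul]
    conv_lhs => rw [hw]
    rw [TensorProduct.tmul_add, mul_comm r, ← Algebra.smul_def, TensorProduct.smul_tmul,
      Algebra.algebraMap_eq_smul_one]

theorem tS_reg (s : R ⊗[k] DegV k) (h : tS k R * s = 0) : s = 0 := by
  have h1 : ∀ s, tS k R * s = LinearMap.lTensor R (LinearMap.mulLeft k (degT k)) s := by
    intro s
    induction s with
    | zero => simp
    | add x y hx hy => rw [mul_add, hx, hy, map_add]
    | tmul r v => simp [tS]
  have h2 : Function.Injective (LinearMap.lTensor R (LinearMap.mulLeft k (degT k))) := by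
    apply Module.Flat.lTensor_preserves_injective_linearMap
    intro a b hab
    exact mul_left_cancel₀ (degT_ne k) hab
  apply h2
  rw [← h1, h, map_zero]

/-- `R² ⊗ V = (R ⊗ V)²`. -/
def pG : (Fin 2 → R) ⊗[k] DegV k →ₗ[k] (Fin 2 → R ⊗[k] DegV k) :=
  LinearMap.pi fun i => LinearMap.rTensor (DegV k) (LinearMap.proj i)

/-- `(R ⊗ V)² = R² ⊗ V`. -/
def pH : (Fin 2 → R ⊗[k] DegV k) →ₗ[k] (Fin 2 → R) ⊗[k] DegV k :=
  ∑ i, LinearMap.rTensor (DegV k) (LinearMap.single k (fun _ => R) i) ∘ₗ LinearMap.proj i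

theorem pG_tmul (x : Fin 2 → R) (v : DegV k) : pG k R (x ⊗ₜ v) = fun i => x i ⊗ₜ v := by
  ext i; simp [pG]

theorem pH_pG (z) : pH k R (pG k R z) = z := by
  induction z with
  | zero => simp
  | add x y hx hy => rw [map_add, map_add, hx, hy]
  | tmul x v =>
    rw [pG_tmul]
    simp only [pH, LinearMap.sum_apply, LinearMap.comp_apply, LinearMap.proj_apply,
      LinearMap.rTensor_tmul, ← TensorProduct.sum_tmul]
    congr 1
    ext i
    fin_cases i <;> simp

theorem pG_pH (u) : pG k R (pH k R u) = u := by
  have h : ∀ (i j : Fin 2) (s : R ⊗[k] DegV k), LinearMap.rTensor (DegV k) (LinearMap.proj i)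
      (LinearMap.rTensor (DegV k) (LinearMap.single k (fun _ => R) j) s)
        = if i = j then s else 0 := by
    intro i j s
    induction s with
    | zero => simp
    | add x y hx hy => rw [map_add, map_add, hx, hy]; split_ifs <;> simp
    | tmul r v =>
      simp only [LinearMap.rTensor_tmul, LinearMap.proj_apply, LinearMap.single_apply,
        Pi.single_apply]
      split_ifs <;> simp
  ext i
  simp only [pG, pH, LinearMap.pi_apply, LinearMap.sum_apply, LinearMap.comp_apply, map_sum,
    LinearMap.proj_apply, h]
  simp

theorem pG_mat (P : Matrix (Fin 2) (Fin 2) R) (z) :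
    pG k R (LinearMap.rTensor (DegV k) ((Matrix.toLin' P).restrictScalars k) z)
      = (P.map (iS k R)).mulVec (pG k R z) := by
  induction z with
  | zero => simp
  | add x y hx hy => simp only [map_add, hx, hy, Matrix.mulVec_add]
  | tmul x v =>
    rw [LinearMap.rTensor_tmul, pG_tmul, pG_tmul]
    ext i
    simp [Matrix.mulVec, dotProduct, iS_apply, TensorProduct.sum_tmul, TensorProduct.add_tmul]

theorem pG_smul (r : R) (v : DegV k) (z) :
    pG k R (TensorProduct.map (Algebra.lsmul k k (Fin 2 → R) r) (LinearMap.mulLeft k v) z)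
      = (r ⊗ₜ[k] v) • pG k R z := by
  induction z with
  | zero => simp
  | add x y hx hy => simp only [map_add, hx, hy, smul_add]
  | tmul x w =>
    rw [TensorProduct.map_tmul, pG_tmul, pG_tmul]
    ext i
    simp

variable {k R}
variable {M : Type} [AddCommGroup M] [Module R M] [Module k M] [IsScalarTower k R M]

/-- The map `(R ⊗ V)² → M ⊗ V` induced by `R² → M`. -/
def gM (p : (Fin 2 → R) →ₗ[R] M) : (Fin 2 → R ⊗[k] DegV k) →ₗ[k] M ⊗[k] DegV k :=
  LinearMap.rTensor (DegV k) (p.restrictScalars k) ∘ₗ pH k R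

theorem gM_smul (p : (Fin 2 → R) →ₗ[R] M) (r : R) (v : DegV k) (u : Fin 2 → R ⊗[k] DegV k) :
    gM p ((r ⊗ₜ[k] v) • u) =
      TensorProduct.map (Algebra.lsmul k k M r) (LinearMap.mulLeft k v) (gM p u) := by
  obtain ⟨z, rfl⟩ : ∃ z, pG k R z = u := ⟨_, pG_pH k R u⟩
  rw [← pG_smul, gM, LinearMap.comp_apply, LinearMap.comp_apply, pH_pG, pH_pG]
  induction z with
  | zero => simp
  | add x y hx hy => simp only [map_add, hx, hy]
  | tmul x w => simp

theorem gM_surj (p : (Fin 2 → R) →ₗ[R] M) (hp : Function.Surjective p) :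
    Function.Surjective (gM (k := k) p) := by
  intro z
  obtain ⟨w, hw⟩ := LinearMap.rTensor_surjective (DegV k) (g := p.restrictScalars k) hp z
  exact ⟨pG k R w, by rw [gM, LinearMap.comp_apply, pH_pG, hw]⟩

theorem gM_ker (p : (Fin 2 → R) →ₗ[R] M) (hp : Function.Surjective p)
    (P : Matrix (Fin 2) (Fin 2) R) (hP : LinearMap.ker p = LinearMap.range (Matrix.toLin' P))
    (u : Fin 2 → R ⊗[k] DegV k) :
    gM p u = 0 ↔ ∃ w, u = (P.map (iS k R)).mulVec w := by
  have hex : Function.Exact ((Matrix.toLin' P).restrictScalars k) (p.restrictScalars k) := by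
    intro x
    have : x ∈ LinearMap.ker p ↔ x ∈ LinearMap.range (Matrix.toLin' P) := by rw [hP]
    simpa using this
  have hex2 := rTensor_exact (DegV k) hex hp
  obtain ⟨z, rfl⟩ : ∃ z, pG k R z = u := ⟨_, pG_pH k R u⟩
  rw [gM, LinearMap.comp_apply, pH_pG, hex2 z]
  constructor
  · rintro ⟨y, rfl⟩
    exact ⟨_, pG_mat k R P y⟩
  · rintro ⟨w, hw⟩
    refine ⟨pH k R w, ?_⟩
    have := pG_mat k R P (pH k R w)
    rw [pG_pH, ← hw] at this
    rw [← pH_pG k R z, ← this, pH_pG]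

end core

section deg

variable {k : Type} [Field k] {R : Type} [CommRing R] [Algebra k R]

theorem ev_mulVec (F : Matrix (Fin 2) (Fin 2) (R ⊗[k] DegV k)) (u : Fin 2 → R ⊗[k] DegV k) :
    (fun i => evS k R (F.mulVec u i)) =
      (F.map (evS k R)).mulVec (fun i => evS k R (u i)) := by
  ext i
  simp [Matrix.mulVec, dotProduct]

theorem ev_split_vec (u : Fin 2 → R ⊗[k] DegV k) :
    ∃ u', u = (fun i => iS k R (evS k R (u i))) + tS k R • u' := by
  choose u' hu' using fun i => evS_split k R (u i)
  exact ⟨u', funext hu'⟩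

/-- The special fibre. -/
theorem quot_clause (N : Type) [AddCommGroup N] [Module R N]
    (Q : Type) [AddCommGroup Q] [Module (R ⊗[k] DegV k) Q] (g : Q →+ N)
    (hr : ∀ (r : R) (q : Q), g ((r ⊗ₜ[k] (1 : DegV k)) • q) = r • g q)
    (hs : Function.Surjective g)
    (ht : ∀ q, g (tS k R • q) = 0)
    (hk : ∀ q, g q = 0 → ∃ q', q = tS k R • q') :
    letI := rRestrict k R (Q ⧸ LinearMap.range (tSmul k R Q))
    Nonempty ((Q ⧸ LinearMap.range (tSmul k R Q)) ≃ₗ[R] N) := by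
  let _ := rRestrict k R (Q ⧸ LinearMap.range (tSmul k R Q))
  let G : (Q ⧸ LinearMap.range (tSmul k R Q)) →+ N :=
    QuotientAddGroup.lift (LinearMap.range (tSmul k R Q)).toAddSubgroup g (by
      rintro _ ⟨q, rfl⟩
      exact ht q)
  have hG : ∀ q, G (Submodule.Quotient.mk q) = g q := fun _ => rfl
  let L : (Q ⧸ LinearMap.range (tSmul k R Q)) →ₗ[R] N :=
    { toFun := G
      map_add' := map_add G
      map_smul' := by
        intro r q
        induction q using Submodule.Quotient.induction_on with
        | H q => exact hr r q }
  refine ⟨LinearEquiv.ofBijective L ⟨?_, ?_⟩⟩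
  · rw [injective_iff_map_eq_zero]
    intro q hq
    induction q using Submodule.Quotient.induction_on with
    | H q =>
      obtain ⟨q', rfl⟩ := hk q hq
      rw [Submodule.Quotient.mk_eq_zero]
      exact ⟨q', rfl⟩
  · intro n
    obtain ⟨q, rfl⟩ := hs n
    exact ⟨Submodule.Quotient.mk q, rfl⟩

theorem degenerates_of_matrices
    {M : Type} [AddCommGroup M] [Module R M] {N : Type} [AddCommGroup N] [Module R N]
    (pM : (Fin 2 → R) →ₗ[R] M) (hpM : Function.Surjective pM)
    (pN : (Fin 2 → R) →ₗ[R] N) (hpN : Function.Surjective pN)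
    (F1 F0 G0 : Matrix (Fin 2) (Fin 2) R)
    (hF1 : LinearMap.ker pM = LinearMap.range (Matrix.toLin' F1))
    (hF0 : LinearMap.ker pN = LinearMap.range (Matrix.toLin' F0))
    (F G A A' B B' : Matrix (Fin 2) (Fin 2) (R ⊗[k] DegV k))
    (hF : F.map (evS k R) = F0) (hG : G.map (evS k R) = G0) (hFG : F * G = 0)
    (hex : ∀ x, F0.mulVec x = 0 → ∃ y, x = G0.mulVec y)
    (m : ℕ)
    (hA : A * F = F1.map (iS k R) * B) (hA' : A' * F1.map (iS k R) = F * B')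
    (hAA : A * A' = tS k R ^ m • 1) (hAA' : A' * A = tS k R ^ m • 1) :
    Degenerates k R M N := by
  have hmk : ∀ u : Fin 2 → R ⊗[k] DegV k,
      (Submodule.Quotient.mk u : _ ⧸ LinearMap.range (Matrix.toLin' F)) = 0 ↔
        ∃ w, u = F.mulVec w := by
    intro u
    rw [Submodule.Quotient.mk_eq_zero]
    constructor
    · rintro ⟨w, rfl⟩; exact ⟨w, by simp⟩
    · rintro ⟨w, rfl⟩; exact ⟨w, by simp⟩
  have hpow : ∀ n : ℕ, tS k R ^ n = (1 : R) ⊗ₜ[k] (degT k ^ n) := by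
    intro n; rw [tS, Algebra.TensorProduct.tmul_pow, one_pow]
  refine ⟨(Fin 2 → R ⊗[k] DegV k) ⧸ LinearMap.range (Matrix.toLin' F), inferInstance,
    inferInstance, inferInstance, ?_, ?_, ?_⟩
  · let _ := vRestrict k R ((Fin 2 → R ⊗[k] DegV k) ⧸ LinearMap.range (Matrix.toLin' F))
    apply flat_of_t
    intro q hq
    induction q using Submodule.Quotient.induction_on with
    | H u =>
      have h1 : (Submodule.Quotient.mk (tS k R • u) :
        _ ⧸ LinearMap.range (Matrix.toLin' F)) = 0 := hq
      obtain ⟨w, hw⟩ := (hmk _).1 h1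
      have h2 : F0.mulVec (fun i => evS k R (w i)) = 0 := by
        rw [← hF, ← ev_mulVec, ← hw]
        ext i
        simp [evS_tS]
      obtain ⟨y, hy⟩ := hex _ h2
      obtain ⟨w', hw'⟩ := ev_split_vec (w - G.mulVec (fun i => iS k R (y i)))
      have h3 : (fun i => evS k R ((w - G.mulVec (fun i => iS k R (y i))) i)) = 0 := by
        have h4 := ev_mulVec G (fun i => iS k R (y i))
        simp only [evS_iS] at h4
        rw [hG, ← hy] at h4
        ext i
        have h5 := congrFun h4 i
        simp only [Pi.zero_apply]
        rw [Pi.sub_apply, map_sub, h5, sub_self]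
      have h6 : ∀ i, evS k R ((w - G.mulVec (fun i => iS k R (y i))) i) = 0 := congrFun h3
      simp only [h6, map_zero] at hw'
      have h7 : w = G.mulVec (fun i => iS k R (y i)) + tS k R • w' := by
        rw [sub_eq_iff_eq_add] at hw'
        rw [hw']
        ext i
        simp [add_comm]
      rw [hmk]
      refine ⟨w', ?_⟩
      rw [h7, Matrix.mulVec_add, Matrix.mulVec_mulVec, hFG, Matrix.zero_mulVec, zero_add,
        Matrix.mulVec_smul] at hw
      ext i
      have h8 := congrFun hw i
      simp only [Pi.smul_apply, smul_eq_mul] at h8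
      exact sub_eq_zero.1 (tS_reg k R _ (by rw [mul_sub, h8, sub_self]))
  · let g0 : (Fin 2 → R ⊗[k] DegV k) →+ N :=
      { toFun := fun u => pN (fun i => evS k R (u i))
        map_zero' := by simp only [Pi.zero_apply, map_zero]; exact map_zero pN
        map_add' := fun a b => by
          rw [← map_add]; congr 1; ext i; simp }
    have hg0 : ∀ u, g0 u = pN (fun i => evS k R (u i)) := fun _ => rfl
    have hkerN : ∀ x, pN x = 0 ↔ ∃ y, x = F0.mulVec y := by
      intro x
      rw [← LinearMap.mem_ker, hF0]
      constructor
      · rintro ⟨w, rfl⟩; exact ⟨w, by simp⟩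
      · rintro ⟨w, rfl⟩; exact ⟨w, by simp⟩
    let g : ((Fin 2 → R ⊗[k] DegV k) ⧸ LinearMap.range (Matrix.toLin' F)) →+ N :=
      QuotientAddGroup.lift (LinearMap.range (Matrix.toLin' F)).toAddSubgroup g0 (by
        rintro _ ⟨w, rfl⟩
        show g0 _ = 0
        rw [hg0, hkerN]
        refine ⟨fun i => evS k R (w i), ?_⟩
        rw [← hF, ← ev_mulVec]
        simp)
    have hg : ∀ u, g (Submodule.Quotient.mk u) = pN (fun i => evS k R (u i)) := fun _ => rfl
    apply quot_clause (k := k) N _ g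
    · intro r q
      induction q using Submodule.Quotient.induction_on with
      | H u =>
        rw [← Submodule.Quotient.mk_smul, hg, hg, ← map_smul]
        congr 1
        ext i
        simp [evS_tmul]
    · intro n
      obtain ⟨x, rfl⟩ := hpN n
      exact ⟨Submodule.Quotient.mk (fun i => iS k R (x i)), by rw [hg]; simp only [evS_iS]⟩
    · intro q
      induction q using Submodule.Quotient.induction_on with
      | H u =>
        rw [← Submodule.Quotient.mk_smul, hg]
        simp only [Pi.smul_apply, smul_eq_mul, map_mul, evS_tS, zero_mul]
        exact map_zero pN
    · intro q hq
      induction q using Submodule.Quotient.induction_on with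
      | H u =>
        rw [hg, hkerN] at hq
        obtain ⟨y, hy⟩ := hq
        obtain ⟨u', hu'⟩ := ev_split_vec (u - F.mulVec (fun i => iS k R (y i)))
        have h3 : ∀ i, evS k R ((u - F.mulVec (fun i => iS k R (y i))) i) = 0 := by
          have h4 := ev_mulVec F (fun i => iS k R (y i))
          simp only [evS_iS] at h4
          rw [hF, ← hy] at h4
          intro i
          have h5 := congrFun h4 i
          rw [Pi.sub_apply, map_sub, h5, sub_self]
        simp only [h3, map_zero] at hu'
        refine ⟨Submodule.Quotient.mk u', ?_⟩
        rw [← Submodule.Quotient.mk_smul, ← sub_eq_zero, ← Submodule.Quotient.mk_sub, hmk]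
        refine ⟨fun i => iS k R (y i), ?_⟩
        rw [sub_eq_iff_eq_add] at hu' ⊢
        rw [hu']
        ext i
        simp [add_comm]
  · let _ := vRestrict k R ((Fin 2 → R ⊗[k] DegV k) ⧸ LinearMap.range (Matrix.toLin' F))
    let _ : Module k M := Module.compHom M (algebraMap k R)
    have : IsScalarTower k R M := ⟨fun c r m => by
      rw [Algebra.smul_def, mul_smul]; rfl⟩
    let h : ((Fin 2 → R ⊗[k] DegV k) ⧸ LinearMap.range (Matrix.toLin' F)) →+ M ⊗[k] DegV k :=
      QuotientAddGroup.lift (LinearMap.range (Matrix.toLin' F)).toAddSubgroup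
        ((gM (k := k) pM).toAddMonoidHom.comp (Matrix.toLin' A).toAddMonoidHom) (by
          rintro _ ⟨w, rfl⟩
          show gM (k := k) pM (Matrix.toLin' A (Matrix.toLin' F w)) = 0
          rw [gM_ker pM hpM F1 hF1]
          exact ⟨B.mulVec w, by
            rw [Matrix.toLin'_apply, Matrix.toLin'_apply, Matrix.mulVec_mulVec, hA,
              ← Matrix.mulVec_mulVec]⟩)
    have hh : ∀ u, h (Submodule.Quotient.mk u) = gM (k := k) pM (A.mulVec u) := fun u => by
      rw [← Matrix.toLin'_apply]; rfl
    have hsm : ∀ (r : R) (v : DegV k) q, h ((r ⊗ₜ[k] v) • q) =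
        TensorProduct.map (Algebra.lsmul k k M r) (LinearMap.mulLeft k v) (h q) := by
      intro r v q
      induction q using Submodule.Quotient.induction_on with
      | H u => rw [← Submodule.Quotient.mk_smul, hh, hh, Matrix.mulVec_smul, gM_smul]
    refine loc_clause k M R _ (fun r => rAct k R _ r) h ?_ ?_ ?_ ?_
    · intro v q
      refine (hsm 1 v q).trans ?_
      rw [map_one]; rfl
    · intro r q
      refine (hsm r 1 q).trans ?_
      rw [LinearMap.mulLeft_one]; rfl
    · intro q hq
      refine ⟨m, ?_⟩
      induction q using Submodule.Quotient.induction_on with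
      | H u =>
        rw [hh, gM_ker pM hpM F1 hF1] at hq
        obtain ⟨w, hw⟩ := hq
        show ((1 : R) ⊗ₜ[k] (degT k ^ m)) • _ = (0 : _ ⧸ LinearMap.range (Matrix.toLin' F))
        rw [← Submodule.Quotient.mk_smul, hmk]
        refine ⟨B'.mulVec w, ?_⟩
        rw [Matrix.mulVec_mulVec, ← hA', ← Matrix.mulVec_mulVec, ← hw, Matrix.mulVec_mulVec, hAA',
          ← hpow, Matrix.smul_mulVec, Matrix.one_mulVec]
    · intro z
      obtain ⟨u, rfl⟩ := gM_surj (k := k) pM hpM z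
      refine ⟨m, Submodule.Quotient.mk (A'.mulVec u), ?_⟩
      rw [hh, Matrix.mulVec_mulVec, hAA, Matrix.smul_mulVec, Matrix.one_mulVec, hpow, gM_smul,
        map_one]
      rfl

end deg

/-! ### The two explicit families -/

theorem mf_exact {A : Type} [CommRing A] [NoZeroDivisors A] (f : A) (hf : f ≠ 0)
    (P P' : Matrix (Fin 2) (Fin 2) A) (h2 : P' * P = f • 1)
    (x : Fin 2 → A ⧸ Ideal.span {f})
    (hx : (P.map (Ideal.Quotient.mk (Ideal.span {f}))).mulVec x = 0) :
    ∃ y, x = (P'.map (Ideal.Quotient.mk (Ideal.span {f}))).mulVec y := by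
  choose X hX using fun i => Ideal.Quotient.mk_surjective (x i)
  have hmv : ∀ (T : Matrix (Fin 2) (Fin 2) A) (u : Fin 2 → A) (i : Fin 2),
      (T.map (Ideal.Quotient.mk (Ideal.span {f}))).mulVec
        (fun i => Ideal.Quotient.mk (Ideal.span {f}) (u i)) i
        = Ideal.Quotient.mk (Ideal.span {f}) (T.mulVec u i) := by
    intro T u i
    simp [Matrix.mulVec, dotProduct]
  obtain rfl : (fun i => Ideal.Quotient.mk (Ideal.span {f}) (X i)) = x := funext hX
  have h3 : ∀ i, ∃ z, P.mulVec X i = f * z := by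
    intro i
    have h4 := congrFun hx i
    rw [hmv, Pi.zero_apply, Ideal.Quotient.eq_zero_iff_mem, Ideal.mem_span_singleton] at h4
    exact h4
  choose z hz using h3
  have h5 : P.mulVec X = f • z := funext hz
  have h6 : f • X = f • P'.mulVec z := by
    rw [← Matrix.mulVec_smul, ← h5, Matrix.mulVec_mulVec, h2, Matrix.smul_mulVec,
      Matrix.one_mulVec]
  have h7 : X = P'.mulVec z := by
    ext i
    have h8 : f * (X i - P'.mulVec z i) = 0 := by
      have h9 : f * X i = f * P'.mulVec z i := congrFun h6 i
      rw [mul_sub, h9, sub_self]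
    exact sub_eq_zero.1 ((mul_eq_zero.1 h8).resolve_left hf)
  refine ⟨fun i => Ideal.Quotient.mk (Ideal.span {f}) (z i), ?_⟩
  ext i
  rw [hmv, ← h7]

theorem dxy_zero (k : Type) [Field k] : dx k ^ 2 * dy k = 0 := by
  rw [dx, dy, ← map_pow, ← map_mul, Ideal.Quotient.eq_zero_iff_mem]
  exact Ideal.mem_span_singleton_self _

theorem mvX_ne (k : Type) [Field k] (i : Fin 2) :
    (MvPowerSeries.X i : MvPowerSeries (Fin 2) k) ≠ 0 := by
  intro h
  have h1 := congrArg (MvPowerSeries.coeff (Finsupp.single i 1)) h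
  rw [MvPowerSeries.coeff_index_single_self_X, map_zero] at h1
  exact one_ne_zero h1

theorem xxy_ne (k : Type) [Field k] :
    (MvPowerSeries.X (0 : Fin 2) : MvPowerSeries (Fin 2) k) ^ 2 *
      (MvPowerSeries.X (1 : Fin 2) : MvPowerSeries (Fin 2) k) ≠ 0 :=
  mul_ne_zero (pow_ne_zero _ (mvX_ne k _)) (mvX_ne k _)

theorem exact_plus (k : Type) [Field k] (n : ℕ) (x : Fin 2 → DinfRing k)
    (hx : (!![dx k, dy k ^ n; 0, -dx k]).mulVec x = 0) :
    ∃ y, x = (!![dx k * dy k, dy k ^ (n + 1); 0, -(dx k * dy k)]).mulVec y := by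
  let X0 : MvPowerSeries (Fin 2) k := MvPowerSeries.X 0
  let Y0 : MvPowerSeries (Fin 2) k := MvPowerSeries.X 1
  have := mf_exact (X0 ^ 2 * Y0) (xxy_ne k) !![X0, Y0 ^ n; 0, -X0]
    !![X0 * Y0, Y0 ^ (n + 1); 0, -(X0 * Y0)]
    (by ext i j; fin_cases i <;> fin_cases j <;> simp <;> ring) x (by
      convert hx using 2
      ext i j; fin_cases i <;> fin_cases j <;> simp [dx, dy, X0, Y0])
  obtain ⟨y, hy⟩ := this
  refine ⟨y, hy.trans ?_⟩
  congr 1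
  ext i j; fin_cases i <;> fin_cases j <;> simp [dx, dy, X0, Y0]

theorem exact_minus (k : Type) [Field k] (n : ℕ) (x : Fin 2 → DinfRing k)
    (hx : (!![dx k * dy k, dy k ^ (n + 1); 0, -(dx k * dy k)]).mulVec x = 0) :
    ∃ y, x = (!![dx k, dy k ^ n; 0, -dx k]).mulVec y := by
  let X0 : MvPowerSeries (Fin 2) k := MvPowerSeries.X 0
  let Y0 : MvPowerSeries (Fin 2) k := MvPowerSeries.X 1
  have := mf_exact (X0 ^ 2 * Y0) (xxy_ne k) !![X0 * Y0, Y0 ^ (n + 1); 0, -(X0 * Y0)]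
    !![X0, Y0 ^ n; 0, -X0]
    (by ext i j; fin_cases i <;> fin_cases j <;> simp <;> ring) x (by
      convert hx using 2
      ext i j; fin_cases i <;> fin_cases j <;> simp [dx, dy, X0, Y0])
  obtain ⟨y, hy⟩ := this
  refine ⟨y, hy.trans ?_⟩
  congr 1
  ext i j; fin_cases i <;> fin_cases j <;> simp [dx, dy, X0, Y0]

/-- The family degenerating `Mₙ⁺` to `Mₙ₊₂⁺`, over any commutative ring. -/
def famP {S : Type} [CommRing S] (n : ℕ) (x y t : S) : Matrix (Fin 2) (Fin 2) S :=
  !![x + t * y ^ (n + 1), y ^ (n + 2); t ^ 2 * y ^ n, -x + t * y ^ (n + 1)]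

/-- The partner of `famP`, so that the product is `x²`. -/
def famG {S : Type} [CommRing S] (n : ℕ) (x y t : S) : Matrix (Fin 2) (Fin 2) S :=
  !![x - t * y ^ (n + 1), y ^ (n + 2); t ^ 2 * y ^ n, -x - t * y ^ (n + 1)]

theorem dS_zero (k : Type) [Field k] :
    iS k (DinfRing k) (dx k) ^ 2 * iS k (DinfRing k) (dy k) = 0 := by
  rw [← map_pow, ← map_mul, dxy_zero, map_zero]

theorem deg_plus (k : Type) [Field k] (n : ℕ) :
    Degenerates k (DinfRing k) (Mplus k n) (Mplus k (n + 2)) := by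
  have h0 := dS_zero k
  have ht := evS_tS k (DinfRing k)
  have hx := evS_iS k (DinfRing k) (dx k)
  have hy := evS_iS k (DinfRing k) (dy k)
  set x := iS k (DinfRing k) (dx k) with hxd
  set y := iS k (DinfRing k) (dy k) with hyd
  set t := tS k (DinfRing k) with htd
  refine degenerates_of_matrices (k := k) (R := DinfRing k)
    (Submodule.mkQ _) (Submodule.mkQ_surjective _) (Submodule.mkQ _) (Submodule.mkQ_surjective _)
    _ _ _ (Submodule.ker_mkQ _) (Submodule.ker_mkQ _)
    (famP n x y t) (y • famG n x y t) !![0, 1; -t ^ 2, t * y] !![t * y, -1; t ^ 2, 0]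
    !![0, -1; t ^ 2, t * y] !![t * y, 1; -t ^ 2, 0]
    ?_ ?_ ?_ (exact_plus k (n + 2)) 2 ?_ ?_ ?_ ?_
  · ext i j; fin_cases i <;> fin_cases j <;> simp [famP, ht, hx, hy]
  · ext i j; fin_cases i <;> fin_cases j <;> simp [famG, ht, hx, hy] <;> ring
  · ext i j
    fin_cases i <;> fin_cases j <;> simp [famG, famP] <;>
      first | ring1 | linear_combination h0
  · ext i j
    fin_cases i <;> fin_cases j <;> 
      simp [Matrix.mul_apply, Fin.sum_univ_two, famP, ← hxd, ← hyd] <;> ring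
  · ext i j
    fin_cases i <;> fin_cases j <;> 
      simp [Matrix.mul_apply, Fin.sum_univ_two, famP, ← hxd, ← hyd] <;> ring
  · ext i j
    fin_cases i <;> fin_cases j <;> simp [← htd] <;> ring
  · ext i j
    fin_cases i <;> fin_cases j <;> simp [← htd] <;> ring

theorem deg_minus (k : Type) [Field k] (n : ℕ) :
    Degenerates k (DinfRing k) (Mminus k n) (Mminus k (n + 2)) := by
  have h0 := dS_zero k
  have ht := evS_tS k (DinfRing k)
  have hx := evS_iS k (DinfRing k) (dx k)
  have hy := evS_iS k (DinfRing k) (dy k)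
  set x := iS k (DinfRing k) (dx k) with hxd
  set y := iS k (DinfRing k) (dy k) with hyd
  set t := tS k (DinfRing k) with htd
  refine degenerates_of_matrices (k := k) (R := DinfRing k)
    (Submodule.mkQ _) (Submodule.mkQ_surjective _) (Submodule.mkQ _) (Submodule.mkQ_surjective _)
    _ _ _ (Submodule.ker_mkQ _) (Submodule.ker_mkQ _)
    (y • famP n x y t) (famG n x y t) !![0, 1; -t ^ 2, t * y] !![t * y, -1; t ^ 2, 0]
    !![0, -1; t ^ 2, t * y] !![t * y, 1; -t ^ 2, 0]
    ?_ ?_ ?_ (exact_minus k (n + 2)) 2 ?_ ?_ ?_ ?_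
  · ext i j; fin_cases i <;> fin_cases j <;> simp [famP, ht, hx, hy] <;> ring
  · ext i j; fin_cases i <;> fin_cases j <;> simp [famG, ht, hx, hy]
  · ext i j
    fin_cases i <;> fin_cases j <;> simp [famG, famP] <;>
      first | ring1 | linear_combination h0
  · ext i j
    fin_cases i <;> fin_cases j <;> 
      simp [Matrix.mul_apply, Fin.sum_univ_two, famP, ← hxd, ← hyd] <;> ring
  · ext i j
    fin_cases i <;> fin_cases j <;> 
      simp [Matrix.mul_apply, Fin.sum_univ_two, famP, ← hxd, ← hyd] <;> ring
  · ext i j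
    fin_cases i <;> fin_cases j <;> simp [← htd] <;> ring
  · ext i j
    fin_cases i <;> fin_cases j <;> simp [← htd] <;> ring


/-- `Mₙ⁺ ⇒_deg Mₙ₊₂⁺` and `Mₙ⁻ ⇒_deg Mₙ₊₂⁻`
over `R = k[[x,y]]/(x²y)` for `n ≥ 1`. -/
theorem Mplus_Mminus_degeneration (k : Type) [Field k] (n : ℕ) (hn : 1 ≤ n) :
    Degenerates k (DinfRing k) (Mplus k n) (Mplus k (n + 2)) ∧
    Degenerates k (DinfRing k) (Mminus k n) (Mminus k (n + 2)) := by
  exact ⟨deg_plus k n, deg_minus k n⟩
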